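/- Let α ∈ (−1/2, 0), β := 2α+1, η > 0, κ > 0, and K_α(s,t) := η√(2α+1)(t−s)^α for 0 ≤ s < t. For ε ∈ (0,1] set V̄_ε² := sup_{t∈[0,1]} ∫₀ᵗ (e^{−κε(t−s)} − 1)²·K_α(s,t)² ds. Then: (i) V̄_ε² ≤ 2η² for every ε ∈ (0,1], and V̄_ε² → 0 as ε ↓ 0; and (ii) for any constant C > 0 and any family (M_ε)_{ε∈(0,1]} of nonnegative random variables satisfying ℙ(M_ε > x) ≤ C·exp(−x²/(2V̄_ε²)) for all x > 0, one has limsup_{ε↓0} ε^β log ℙ(ε^{β/2} M_ε > δ) = −∞ for every δ > 0. (Here M_ε plays the role of sup_{t∈[0,1]} |∫₀ᵗ K_α(s,t)[e^{−κε(t−s)} − 1] dW_s|, so (ii) expresses that (ε^{β/2}∫₀^· e^{−κε(·−s)}K_α(s,·)dW_s)_{ε>0} and (ε^{β/2}∫₀^· K_α(s,·)dW_s)_{ε>0} are exponentially equivalent at speed ε^{−β}.) -/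

import Mathlib

open MeasureTheory ProbabilityTheory Filter Set
open scoped ENNReal NNReal

noncomputable section

/-- The time interval `[0,1]`. -/
abbrev I01 : Set ℝ := Set.Icc (0:ℝ) 1

/-- The rough Bergomi kernel `K_α(s,t) = η √(2α+1) (t-s)^α`. -/
noncomputable def Kker (α η : ℝ) (s t : ℝ) : ℝ := η * Real.sqrt (2*α+1) * (t - s) ^ α

/-- Extended-real logarithm of an `ℝ≥0∞` number (`log 0 = ⊥`, `log ⊤ = ⊤`). -/
noncomputable def elog (x : ℝ≥0∞) : EReal :=
  if x = 0 then ⊥ else if x = ⊤ then ⊤ else ((Real.log x.toReal : ℝ) : EReal)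

theorem Kker_sq {α η s t : ℝ} (hα : α ∈ Ioo (-(1:ℝ)/2) 0) (hst : s ≤ t) :
    (Kker α η s t)^2 = η^2 * (2*α+1) * (t - s) ^ (2*α) := by
  obtain ⟨h1, h2⟩ := hα
  have hts : 0 ≤ t - s := sub_nonneg.mpr hst
  rw [Kker, mul_pow, mul_pow, Real.sq_sqrt (by linarith), ← Real.rpow_mul_natCast hts, mul_comm 2 α]
  norm_num

theorem intervalIntegrable_sub_rpow {p : ℝ} (hp : -1 < p) (t : ℝ) :
    IntervalIntegrable (fun s => (t - s) ^ p) volume 0 t := by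
  simpa using (intervalIntegral.intervalIntegrable_rpow' hp (a := t) (b := 0)).comp_sub_left t

theorem integral_sub_rpow {p : ℝ} (hp : -1 < p) (t : ℝ) :
    ∫ s in (0:ℝ)..t, (t - s) ^ p = t ^ (p + 1) / (p + 1) := by
  rw [intervalIntegral.integral_comp_sub_left (fun x => x ^ p) t, integral_rpow (Or.inl hp)]
  simp [Real.zero_rpow (show p + 1 ≠ 0 by linarith)]

theorem integrableOn_Kker_sq {α : ℝ} (η : ℝ) {t : ℝ} (hα : α ∈ Ioo (-(1:ℝ)/2) 0) (ht : 0 ≤ t) :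
    IntegrableOn (fun s => (Kker α η s t)^2) (Icc 0 t) := by
  have h : IntegrableOn (fun s => η^2 * (2*α+1) * (t - s) ^ (2*α)) (Icc 0 t) :=
    ((intervalIntegrable_iff_integrableOn_Icc_of_le ht).mp
      (intervalIntegrable_sub_rpow (by linarith [hα.1]) t)).const_mul _
  exact h.congr_fun (fun s hs => (Kker_sq hα hs.2).symm) measurableSet_Icc

theorem setIntegral_Kker_sq {α : ℝ} (η : ℝ) {t : ℝ} (hα : α ∈ Ioo (-(1:ℝ)/2) 0) (ht : 0 ≤ t) :
    ∫ s in Icc 0 t, (Kker α η s t)^2 = η^2 * t ^ (2*α+1) := by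
  rw [setIntegral_congr_fun measurableSet_Icc (fun s hs => Kker_sq hα hs.2),
    integral_Icc_eq_integral_Ioc, ← intervalIntegral.integral_of_le ht,
    intervalIntegral.integral_const_mul, integral_sub_rpow (by linarith [hα.1])]
  have : 2*α+1 ≠ 0 := by linarith [hα.1]
  field_simp

theorem sq_exp_neg_sub_one_le_one {x : ℝ} (hx : 0 ≤ x) : (Real.exp (-x) - 1)^2 ≤ 1 := by
  have h1 : Real.exp (-x) ≤ 1 := Real.exp_le_one_iff.mpr (by linarith)
  nlinarith [Real.exp_pos (-x)]

theorem sq_exp_neg_sub_one_le_sq {x : ℝ} (hx : 0 ≤ x) : (Real.exp (-x) - 1)^2 ≤ x^2 := by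
  have h1 : Real.exp (-x) ≤ 1 := Real.exp_le_one_iff.mpr (by linarith)
  nlinarith [Real.add_one_le_exp (-x)]

theorem integrableOn_damped_Kker_sq {α : ℝ} (η : ℝ) {t c : ℝ} (hα : α ∈ Ioo (-(1:ℝ)/2) 0)
    (ht : 0 ≤ t) (hc : 0 ≤ c) :
    IntegrableOn (fun s => (Real.exp (-(c * (t-s))) - 1)^2 * (Kker α η s t)^2) (Icc 0 t) := by
  refine (integrableOn_Kker_sq η hα ht).bdd_mul (c := 1) (by fun_prop) ?_
  filter_upwards [ae_restrict_mem measurableSet_Icc] with s hs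
  rw [Real.norm_of_nonneg (sq_nonneg _)]
  exact sq_exp_neg_sub_one_le_one (mul_nonneg hc (sub_nonneg.mpr hs.2))

theorem setIntegral_damped_Kker_sq_le {α : ℝ} (η : ℝ) {t c b : ℝ} (hα : α ∈ Ioo (-(1:ℝ)/2) 0)
    (ht : t ∈ I01) (hc : 0 ≤ c)
    (hb : ∀ s ∈ Icc 0 t, (Real.exp (-(c * (t-s))) - 1)^2 ≤ b) :
    ∫ s in Icc 0 t, (Real.exp (-(c * (t-s))) - 1)^2 * (Kker α η s t)^2 ≤ b * η^2 := by
  have hb0 : 0 ≤ b := (sq_nonneg _).trans (hb 0 ⟨le_rfl, ht.1⟩)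
  calc _ ≤ ∫ s in Icc 0 t, b * (Kker α η s t)^2 :=
        setIntegral_mono_on (integrableOn_damped_Kker_sq η hα ht.1 hc)
          ((integrableOn_Kker_sq η hα ht.1).const_mul b) measurableSet_Icc
          (fun s hs => mul_le_mul_of_nonneg_right (hb s hs) (sq_nonneg _))
    _ = b * (η^2 * t ^ (2*α+1)) := by
        rw [integral_const_mul, setIntegral_Kker_sq η hα ht.1]
    _ ≤ b * η^2 := by
        have := Real.rpow_le_one ht.1 ht.2 (show 0 ≤ 2*α+1 by linarith [hα.1])
        gcongr
        exact mul_le_of_le_one_right (sq_nonneg η) this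

theorem setIntegral_damped_Kker_sq_le_sq {α : ℝ} (η : ℝ) {t c : ℝ} (hα : α ∈ Ioo (-(1:ℝ)/2) 0)
    (ht : t ∈ I01) (hc : 0 ≤ c) :
    ∫ s in Icc 0 t, (Real.exp (-(c * (t-s))) - 1)^2 * (Kker α η s t)^2 ≤ η^2 := by
  simpa using setIntegral_damped_Kker_sq_le (b := 1) η hα ht hc fun s hs =>
    sq_exp_neg_sub_one_le_one (mul_nonneg hc (sub_nonneg.mpr hs.2))

theorem setIntegral_damped_Kker_sq_le_sq_mul_sq {α : ℝ} (η : ℝ) {t c : ℝ}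
    (hα : α ∈ Ioo (-(1:ℝ)/2) 0) (ht : t ∈ I01) (hc : 0 ≤ c) :
    ∫ s in Icc 0 t, (Real.exp (-(c * (t-s))) - 1)^2 * (Kker α η s t)^2 ≤ c^2 * η^2 := by
  refine setIntegral_damped_Kker_sq_le η hα ht hc fun s hs => ?_
  have hts : 0 ≤ t - s := sub_nonneg.mpr hs.2
  refine (sq_exp_neg_sub_one_le_sq (mul_nonneg hc hts)).trans ?_
  gcongr
  exact mul_le_of_le_one_right hc (by linarith [ht.2, hs.1])

theorem setIntegral_damped_Kker_sq_pos {α η t c : ℝ} (hα : α ∈ Ioo (-(1:ℝ)/2) 0) (hη : 0 < η)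
    (ht : 0 < t) (hc : 0 < c) :
    0 < ∫ s in Icc 0 t, (Real.exp (-(c * (t-s))) - 1)^2 * (Kker α η s t)^2 := by
  rw [setIntegral_pos_iff_support_of_nonneg_ae (ae_of_all _ fun s => by positivity)
    (integrableOn_damped_Kker_sq η hα ht.le hc.le)]
  have hsub : Ioo 0 t ⊆ Function.support
      (fun s => (Real.exp (-(c * (t-s))) - 1)^2 * (Kker α η s t)^2) ∩ Icc 0 t := by
    refine fun s hs => ⟨?_, Ioo_subset_Icc_self hs⟩
    have hts : 0 < t - s := sub_pos.mpr hs.2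
    have hexp : Real.exp (-(c * (t-s))) < 1 := Real.exp_lt_one_iff.mpr (neg_neg_of_pos (mul_pos hc hts))
    have hβ : 0 < 2*α+1 := by linarith [hα.1]
    have hK : 0 < Kker α η s t := by unfold Kker; positivity
    exact mul_ne_zero (pow_ne_zero 2 (by linarith)) (pow_ne_zero 2 hK.ne')
  exact lt_of_lt_of_le (by simpa using ht) (measure_mono hsub)

theorem mul_elog_le_coe {p : ℝ≥0∞} {a b : ℝ} (hp : p ≠ ⊤) (ha : 0 < a)
    (h : 0 < p.toReal → a * Real.log p.toReal ≤ b) : (a : EReal) * elog p ≤ (b : EReal) := by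
  unfold elog
  split_ifs with h0
  · simp [EReal.coe_mul_bot_of_pos ha]
  · exact_mod_cast h (ENNReal.toReal_pos h0 hp)

/-- Logarithmic tail bound, at speed `1 / r ^ 2`, for the rescaling `r Y` of a random variable `Y`
with Gaussian tails of variance `v`. -/
theorem mul_elog_tail_le {Ω : Type*} [MeasurableSpace Ω] (P : Measure Ω) [IsProbabilityMeasure P]
    {Y : Ω → ℝ} {a r v C δ : ℝ} (hr : 0 < r) (har : r^2 = a) (hC : 0 < C) (hδ : 0 < δ)
    (hY : ∀ x : ℝ, 0 < x → (P {ω | x < Y ω}).toReal ≤ C * Real.exp (-(x^2) / (2 * v))) :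
    (a : EReal) * elog (P {ω | δ < r * Y ω}) ≤ ((a * Real.log C - δ^2 / 2 * v⁻¹ : ℝ) : EReal) := by
  have hset : {ω | δ < r * Y ω} = {ω | δ / r < Y ω} := by
    ext ω
    simp [div_lt_iff₀' hr]
  have ha : 0 < a := har ▸ by positivity
  refine mul_elog_le_coe (measure_ne_top _ _) ha fun hpos => ?_
  rw [hset] at hpos ⊢
  have hlog := Real.log_le_log hpos (hY (δ / r) (by positivity))
  rw [Real.log_mul hC.ne' (Real.exp_pos _).ne', Real.log_exp] at hlog
  refine (mul_le_mul_of_nonneg_left hlog ha.le).trans_eq ?_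
  rw [mul_add, div_pow, har]
  field_simp
  ring

/-- sup-variance bound for the exponentially damped kernel,
convergence `V̄_ε² → 0`, and the resulting exponential-equivalence tail estimate. -/
theorem gamma_kernel_exponential_equivalence
    {Ω : Type*} [MeasurableSpace Ω] (P : Measure Ω) [IsProbabilityMeasure P]
    (α β η κ : ℝ) (hα : α ∈ Set.Ioo (-(1:ℝ)/2) 0) (hβ : β = 2*α+1) (hη : 0 < η)
    (hκ : 0 < κ)
    (Vsq : ℝ → ℝ)
    (hVsq : ∀ ε ∈ Set.Ioc (0:ℝ) 1, Vsq ε =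
      ⨆ t : I01, ∫ s in Set.Icc 0 (t:ℝ),
        (Real.exp (-(κ * ε * ((t:ℝ)-s))) - 1)^2 * (Kker α η s (t:ℝ))^2) :
    (∀ ε ∈ Set.Ioc (0:ℝ) 1, Vsq ε ≤ 2 * η^2) ∧
    Filter.Tendsto (fun ε => Vsq ε) (nhdsWithin 0 (Set.Ioi 0)) (nhds 0) ∧
    (∀ C : ℝ, 0 < C → ∀ M : ℝ → Ω → ℝ,
      (∀ ε ∈ Set.Ioc (0:ℝ) 1, ∀ ω, 0 ≤ M ε ω) →
      (∀ ε ∈ Set.Ioc (0:ℝ) 1, ∀ x : ℝ, 0 < x →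
        (P {ω | x < M ε ω}).toReal ≤ C * Real.exp (-(x^2) / (2 * Vsq ε))) →
      ∀ δ : ℝ, 0 < δ →
        Filter.limsup
          (fun ε : ℝ => ((ε ^ β : ℝ) : EReal) * elog (P {ω | δ < ε ^ (β/2) * M ε ω}))
          (nhdsWithin 0 (Set.Ioi 0)) = (⊥ : EReal)) := by
  have hβpos : 0 < β := by linarith [hα.1]
  have hle : ∀ ε ∈ Ioc (0:ℝ) 1, Vsq ε ≤ η^2 := fun ε hε => by
    rw [hVsq ε hε]
    exact ciSup_le fun t => setIntegral_damped_Kker_sq_le_sq η hα t.2 (mul_pos hκ hε.1).le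
  have hle' : ∀ ε ∈ Ioc (0:ℝ) 1, Vsq ε ≤ (κ * ε)^2 * η^2 := fun ε hε => by
    rw [hVsq ε hε]
    exact ciSup_le fun t => setIntegral_damped_Kker_sq_le_sq_mul_sq η hα t.2 (mul_pos hκ hε.1).le
  have hpos : ∀ ε ∈ Ioc (0:ℝ) 1, 0 < Vsq ε := fun ε hε => by
    rw [hVsq ε hε]
    refine (setIntegral_damped_Kker_sq_pos hα hη one_pos (mul_pos hκ hε.1)).trans_le ?_
    refine le_ciSup (f := fun t : I01 => ∫ s in Icc 0 (t:ℝ),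
      (Real.exp (-(κ * ε * ((t:ℝ)-s))) - 1)^2 * (Kker α η s (t:ℝ))^2) ⟨η^2, ?_⟩
      ⟨1, zero_le_one, le_rfl⟩
    rintro _ ⟨t, rfl⟩
    exact setIntegral_damped_Kker_sq_le_sq η hα t.2 (mul_pos hκ hε.1).le
  have hmem : ∀ᶠ ε : ℝ in nhdsWithin 0 (Ioi 0), ε ∈ Ioc (0:ℝ) 1 :=
    Ioc_mem_nhdsGT one_pos
  have hlim : Tendsto Vsq (nhdsWithin 0 (Ioi 0)) (nhds 0) := by
    refine tendsto_of_tendsto_of_tendsto_of_le_of_le' tendsto_const_nhds ?_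
      (hmem.mono fun ε hε => (hpos ε hε).le) (hmem.mono hle')
    have hcont : Continuous fun ε : ℝ => (κ * ε)^2 * η^2 := by fun_prop
    simpa using (hcont.tendsto 0).mono_left nhdsWithin_le_nhds
  refine ⟨fun ε hε => (hle ε hε).trans (by nlinarith [sq_nonneg η]), hlim, ?_⟩
  intro C hC M _ hM δ hδ
  have hinv : Tendsto (fun ε => (Vsq ε)⁻¹) (nhdsWithin 0 (Ioi 0)) atTop :=
    tendsto_inv_nhdsGT_zero.comp (tendsto_nhdsWithin_iff.mpr ⟨hlim, hmem.mono hpos⟩)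
  have hpow : Tendsto (fun ε : ℝ => ε ^ β * Real.log C) (nhdsWithin 0 (Ioi 0)) (nhds 0) := by
    have h := (Real.continuousAt_rpow_const 0 β (Or.inr hβpos.le)).tendsto
    rw [Real.zero_rpow hβpos.ne'] at h
    simpa using (h.mono_left nhdsWithin_le_nhds).mul_const (Real.log C)
  have hbot : Tendsto (fun ε : ℝ => ε ^ β * Real.log C - δ^2 / 2 * (Vsq ε)⁻¹)
      (nhdsWithin 0 (Ioi 0)) atBot := by
    simpa only [sub_eq_add_neg, Function.comp_def] using hpow.add_atBot
      (tendsto_neg_atTop_atBot.comp (hinv.const_mul_atTop (show 0 < δ^2 / 2 by positivity)))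
  refine Tendsto.limsup_eq (EReal.tendsto_nhds_bot_iff_real.mpr fun x => ?_)
  filter_upwards [hmem, hbot.eventually_lt_atBot x] with ε hε hx
  refine (mul_elog_tail_le P (Real.rpow_pos_of_pos hε.1 _) ?_ hC hδ (hM ε hε)).trans_lt
    (EReal.coe_lt_coe_iff.mpr hx)
  rw [← Real.rpow_mul_natCast hε.1.le]
  norm_num

end
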